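/- Let ω be a 2π-periodic complex-valued function with ω_α∈H^k(𝕋[0,2π]) for an integer k≥0. Then for every a∈ℝ and every α, the k-th α-derivative and the k-th α'-derivative of q₁[ω](α,α') lie in L²[a,a+2π] as functions of the other variable, with (∫_a^{a+2π}|D_α^k q₁[ω](α,α')|²dα')^{1/2} ≤ C‖ω_α‖_k and (∫_a^{a+2π}|D_{α'}^k q₁[ω](α,α')|²dα')^{1/2} ≤ C‖ω_α‖_k, where C depends only on k (in particular is independent of a and α). Likewise, if ω_{αα}∈H^k(𝕋[0,2π]) then (∫_a^{a+2π}|D_α^k q₂[ω](α,α')|²dα')^{1/2} ≤ C‖ω_{αα}‖_k and (∫_a^{a+2π}|D_{α'}^k q₂[ω](α,α')|²dα')^{1/2} ≤ C‖ω_{αα}‖_k with C depending only on k. -/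

import Mathlib

open MeasureTheory Complex Filter
open scoped Real BigOperators

noncomputable section

namespace HeleShaw

/-- k-th Fourier coefficient of a 2π-periodic function `f : ℝ → ℂ`. -/
def fc (f : ℝ → ℂ) (k : ℤ) : ℂ :=
  (1 / (2 * (π : ℂ))) * ∫ α in (0:ℝ)..(2*π), f α * Complex.exp (-Complex.I * (k:ℂ) * (α:ℂ))

/-- Square of the Sobolev `H^s` norm, via Fourier coefficients. -/
def hnormSq (s : ℝ) (f : ℝ → ℂ) : ℝ :=
  (∑' k : ℤ, |(k:ℝ)| ^ (2*s) * ‖fc f k‖^2) + ‖fc f 0‖^2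

/-- The Sobolev `H^s` norm. -/
def hnorm (s : ℝ) (f : ℝ → ℂ) : ℝ := Real.sqrt (hnormSq s f)

/-- Membership in `H^s(𝕋[0,2π])`. -/
def MemH (s : ℝ) (f : ℝ → ℂ) : Prop :=
  Function.Periodic f (2*π) ∧ IntervalIntegrable f volume 0 (2*π) ∧
    Summable (fun k : ℤ => |(k:ℝ)| ^ (2*s) * ‖fc f k‖^2)

/-- Real-valued function. -/
def IsRealFn (f : ℝ → ℂ) : Prop := ∀ α, (f α).im = 0

/-- The projection 𝒬₁ removing Fourier modes `0, ±1`. -/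
def Q1 (f : ℝ → ℂ) (α : ℝ) : ℂ :=
  f α - fc f 0 - fc f 1 * Complex.exp (Complex.I * (α:ℂ))
    - fc f (-1) * Complex.exp (-Complex.I * (α:ℂ))

/-- Membership in `Ḣ^s`: real valued `H^s` functions fixed by 𝒬₁. -/
def MemHdot (s : ℝ) (f : ℝ → ℂ) : Prop :=
  MemH s f ∧ IsRealFn f ∧ fc f 0 = 0 ∧ fc f 1 = 0 ∧ fc f (-1) = 0

/-- The Hilbert transform, via Fourier multipliers `-i sgn k`. -/
def HT (f : ℝ → ℂ) (α : ℝ) : ℂ :=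
  ∑' k : ℤ, (-Complex.I) * (Int.sign k : ℂ) * fc f k * Complex.exp (Complex.I * (k:ℂ) * (α:ℂ))

/-- The commutator `[ℋ, ψ] f = ℋ(ψ f) - ψ ℋ(f)`. -/
def commHT (ψ f : ℝ → ℂ) (α : ℝ) : ℂ :=
  HT (fun β => ψ β * f β) α - ψ α * HT f α

/-- Real cotangent. -/
def rcot (x : ℝ) : ℝ := Real.cos x / Real.sin x

/-- The integral operator 𝒦[z]. -/
def Kop (z f : ℝ → ℂ) (α : ℝ) : ℂ :=
  (1 / (2 * (π:ℂ) * Complex.I)) *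
    ∫ β in (α - π)..(α + π),
      f β * (1 / (z α - z β) - 1 / (2 * deriv z β) * (rcot ((α - β)/2) : ℂ))

/-- The operator 𝒢[z]f = z_α [ℋ, 1/z_α] f + 2 i z_α 𝒦[z] f. -/
def Gop (z f : ℝ → ℂ) (α : ℝ) : ℂ :=
  deriv z α * commHT (fun β => 1 / deriv z β) f α + 2 * Complex.I * deriv z α * Kop z f α

/-- The operator ℱ[z]f = Re((1/i) 𝒢[z] f). -/
def Fop (z f : ℝ → ℂ) (α : ℝ) : ℝ := (Gop z f α / Complex.I).re

/-- The curve ω determined by θ̃ and `c = θ̂(1)` (with `θ̂(-1) = conj c`). -/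
def omegaCurve (θt : ℝ → ℂ) (c : ℂ) (α : ℝ) : ℂ :=
  ∫ τ in (0:ℝ)..α,
    Complex.exp (Complex.I * (τ:ℂ) + Complex.I * c * Complex.exp (Complex.I * (τ:ℂ))
      + Complex.I * (starRingEnd ℂ c) * Complex.exp (-Complex.I * (τ:ℂ)) + Complex.I * θt τ)

/-- θ = θ̃ + θ̂(1) e^{iα} + θ̂(-1) e^{-iα}. -/
def thetaFull (θt : ℝ → ℂ) (c : ℂ) (α : ℝ) : ℂ :=
  θt α + c * Complex.exp (Complex.I * (α:ℂ))
    + (starRingEnd ℂ c) * Complex.exp (-Complex.I * (α:ℂ))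

/-- The constraint (B.4). -/
def ConstraintB4 (θt : ℝ → ℂ) (c : ℂ) : Prop :=
  (∫ α in (0:ℝ)..(2*π),
    Complex.exp (Complex.I * (α:ℂ)
      + Complex.I * ((starRingEnd ℂ c) * Complex.exp (-Complex.I * (α:ℂ))
          + c * Complex.exp (Complex.I * (α:ℂ)) + θt α))) = 0

/-- The vortex sheet strength equation `(I + A_μ ℱ[ω]) γ = (2πσ/L) θ_αα`. -/
def GammaRel (σ L Aμ : ℝ) (θt : ℝ → ℂ) (c : ℂ) (γ : ℝ → ℂ) : Prop :=
  ∀ α, γ α + (Aμ:ℂ) * ((Fop (omegaCurve θt c) γ α : ℝ) : ℂ)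
      = ((2*π*σ/L : ℝ) : ℂ) * deriv (deriv (thetaFull θt c)) α

/-- The normal velocity `U = (π/L) ℋγ + (π/L) Re(𝒢[ω]γ)`. -/
def Ufn (L : ℝ) (ω γ : ℝ → ℂ) (α : ℝ) : ℂ :=
  ((π/L : ℝ) : ℂ) * HT γ α + ((π/L : ℝ) : ℂ) * ((Gop ω γ α).re : ℂ)

/-- The tangential velocity `T`. -/
def Tfn (θ U : ℝ → ℂ) (α : ℝ) : ℂ :=
  (∫ β in (0:ℝ)..α, (1 + deriv θ β) * U β)
    - ((α/(2*π) : ℝ) : ℂ) * ∫ β in (0:ℝ)..(2*π), (1 + deriv θ β) * U β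

/-- Galerkin projection `P_n`, keeping modes `2 ≤ |k| ≤ n`. -/
def Pn (n : ℕ) (f : ℝ → ℂ) (α : ℝ) : ℂ :=
  ∑ k ∈ Finset.Icc (-(n:ℤ)) (n:ℤ),
    if 2 ≤ |k| then fc f k * Complex.exp (Complex.I * (k:ℂ) * (α:ℂ)) else 0

/-- `z_α = (L/(2π)) e^{i(α+θ)}`. -/
def zDeriv (L : ℝ) (θ : ℝ → ℂ) (α : ℝ) : ℂ :=
  ((L/(2*π) : ℝ) : ℂ) * Complex.exp (Complex.I * ((α:ℂ) + θ α))

/-- The curve `z` with `z(0)=0` and `z_α = (L/(2π)) e^{i(α+θ)}`. -/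
def zCurve (L : ℝ) (θ : ℝ → ℂ) (α : ℝ) : ℂ := ∫ τ in (0:ℝ)..α, zDeriv L θ τ

/-- Area enclosed by the curve: `S = (1/2) Im ∫₀^{2π} z_α z* dα`. -/
def areaF (L : ℝ) (θ : ℝ → ℂ) : ℝ :=
  (1/2) * (∫ α in (0:ℝ)..(2*π), zDeriv L θ α * (starRingEnd ℂ) (zCurve L θ α)).im

/-- Divided difference `q₁[ω](α,α') = ∫₀¹ ω_α(tα+(1-t)α') dt`. -/
def q1 (ω : ℝ → ℂ) (α β : ℝ) : ℂ := ∫ t in (0:ℝ)..1, deriv ω (t*α + (1-t)*β)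

/-- Divided difference `q₂[ω](α,α') = ∫₀¹ (t-1) ω_αα((1-t)α + tα') dt`. -/
def q2 (ω : ℝ → ℂ) (α β : ℝ) : ℂ :=
  ∫ t in (0:ℝ)..1, ((t:ℂ) - 1) * deriv (deriv ω) ((1-t)*α + t*β)

/-- System (A.1)-(A.2) at time `t`. -/
def SystemA (σ Aμ : ℝ) (θ : ℝ → ℝ → ℂ) (L : ℝ → ℝ) (γ : ℝ → ℝ → ℂ) (t : ℝ) : Prop :=
  (∀ α, γ t α + (Aμ:ℂ) * ((Fop (zCurve (L t) (θ t)) (γ t) α : ℝ) : ℂ)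
      = ((2*π*σ/(L t) : ℝ) : ℂ) * deriv (deriv (θ t)) α) ∧
  (∀ α, deriv (fun τ => θ τ α) t
      = ((2*π/(L t) : ℝ) : ℂ) * (deriv (Ufn (L t) (zCurve (L t) (θ t)) (γ t)) α
        + Tfn (θ t) (Ufn (L t) (zCurve (L t) (θ t)) (γ t)) α * (1 + deriv (θ t) α))) ∧
  deriv L t = -(∫ α in (0:ℝ)..(2*π),
      ((1 + deriv (θ t) α) * Ufn (L t) (zCurve (L t) (θ t)) (γ t) α)).re

/-- The Galerkin system (C.1)-(C.2) at time `t`. -/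
def GalerkinSystem (n : ℕ) (σ Aμ : ℝ) (θt : ℝ → ℝ → ℂ) (Ln : ℝ → ℝ)
    (c : ℝ → ℂ) (γ : ℝ → ℝ → ℂ) (t : ℝ) : Prop :=
  ConstraintB4 (θt t) (c t) ∧
  fc (γ t) 0 = 0 ∧
  GammaRel σ (Ln t) Aμ (θt t) (c t) (γ t) ∧
  (∀ α, deriv (fun τ => θt τ α) t
     = ((2*π/(Ln t) : ℝ) : ℂ) * Pn n (fun β =>
         deriv (Ufn (Ln t) (omegaCurve (θt t) (c t)) (γ t)) β
         + Tfn (thetaFull (θt t) (c t)) (Ufn (Ln t) (omegaCurve (θt t) (c t)) (γ t)) β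
           * (1 + deriv (thetaFull (θt t) (c t)) β)) α) ∧
  deriv Ln t = -(∫ α in (0:ℝ)..(2*π),
     ((1 + deriv (thetaFull (θt t) (c t)) α)
       * Ufn (Ln t) (omegaCurve (θt t) (c t)) (γ t) α)).re

/-- System (B.1),(B.3),(B.4) at time `t`. -/
def SystemB (σ Aμ : ℝ) (θt : ℝ → ℝ → ℂ) (L : ℝ → ℝ)
    (c : ℝ → ℂ) (γ : ℝ → ℝ → ℂ) (t : ℝ) : Prop :=
  ConstraintB4 (θt t) (c t) ∧
  fc (γ t) 0 = 0 ∧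
  GammaRel σ (L t) Aμ (θt t) (c t) (γ t) ∧
  (∀ α, deriv (fun τ => θt τ α) t
     = ((2*π/(L t) : ℝ) : ℂ) * Q1 (fun β =>
         deriv (Ufn (L t) (omegaCurve (θt t) (c t)) (γ t)) β
         + Tfn (thetaFull (θt t) (c t)) (Ufn (L t) (omegaCurve (θt t) (c t)) (γ t)) β
           * (1 + deriv (thetaFull (θt t) (c t)) β)) α) ∧
  deriv L t = -(∫ α in (0:ℝ)..(2*π),
     ((1 + deriv (thetaFull (θt t) (c t)) α)
       * Ufn (L t) (omegaCurve (θt t) (c t)) (γ t) α)).re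

/-- Membership in the ball 𝓑 of radius ε in `Ḣ^r`. -/
def InBall (r ε : ℝ) (u : ℝ → ℂ) : Prop := MemHdot r u ∧ hnorm r u < ε

/-- Membership in 𝓥. -/
def InV (r ε : ℝ) (u : ℝ → ℂ) (v : ℝ) : Prop := InBall r ε u ∧ |v - 2*π| < 1

/-- Integration by parts against the primitive of an integrable function. -/
lemma integral_deriv_mul_primitive_of_le {f v v' : ℝ → ℂ} {a b : ℝ} (hab : a ≤ b)
    (hf : IntervalIntegrable f volume a b) (hv : ∀ x, HasDerivAt v (v' x) x)
    (hv' : Continuous v') :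
    ∫ x in a..b, v' x * ∫ u in a..x, f u
      = v b * (∫ u in a..b, f u) - ∫ x in a..b, v x * f x := by
  have hvc : Continuous v := continuous_iff_continuousAt.2 fun x => (hv x).continuousAt
  have hint : Integrable (fun p : ℝ × ℝ => v' p.1 * f p.2)
      ((volume.restrict (Set.uIoc a b)).prod (volume.restrict (Set.uIoc a b))) :=
    Integrable.mul_prod (intervalIntegrable_iff.1 (hv'.intervalIntegrable a b))
      (intervalIntegrable_iff.1 hf)
  have hint2 := hint.indicator (s := {p : ℝ × ℝ | p.2 ≤ p.1})
    (measurableSet_le measurable_snd measurable_fst)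
  have hswap := intervalIntegral_intervalIntegral_swap (a := a) (b := b) (c := a) (d := b)
    (F := fun x u => Set.indicator {p : ℝ × ℝ | p.2 ≤ p.1} (fun p => v' p.1 * f p.2) (x, u))
    (by
      rw [IntegrableOn, Measure.volume_eq_prod, ← Measure.prod_restrict]
      exact hint2)
  have h1 : ∫ x in a..b, v' x * ∫ u in a..x, f u = ∫ x in a..b, ∫ u in a..b,
      Set.indicator {p : ℝ × ℝ | p.2 ≤ p.1} (fun p => v' p.1 * f p.2) (x, u) := by
    refine intervalIntegral.integral_congr fun x hx => ?_
    rw [Set.uIcc_of_le hab] at hx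
    rw [← intervalIntegral.integral_indicator hx, ← intervalIntegral.integral_const_mul]
    refine intervalIntegral.integral_congr fun u _ => ?_
    by_cases hu : u ≤ x <;> simp [Set.indicator, hu]
  have h2 : ∀ u ∈ Set.uIcc a b, ∫ x in a..b,
      Set.indicator {p : ℝ × ℝ | p.2 ≤ p.1} (fun p => v' p.1 * f p.2) (x, u)
        = v b * f u - v u * f u := by
    intro u hu
    rw [Set.uIcc_of_le hab] at hu
    have h3 : (∫ x in a..u,
        Set.indicator {p : ℝ × ℝ | p.2 ≤ p.1} (fun p => v' p.1 * f p.2) (x, u)) = 0 := by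
      rw [intervalIntegral.integral_of_le hu.1, integral_Ioc_eq_integral_Ioo]
      refine setIntegral_eq_zero_of_forall_eq_zero fun x hx => ?_
      simp [Set.indicator, hx.2]
    have h4 : (∫ x in u..b,
        Set.indicator {p : ℝ × ℝ | p.2 ≤ p.1} (fun p => v' p.1 * f p.2) (x, u))
          = ∫ x in u..b, v' x * f u := by
      refine intervalIntegral.integral_congr fun x hx => ?_
      rw [Set.uIcc_of_le hu.2] at hx
      simp [Set.indicator, hx.1]
    have hi : ∀ c d, IntervalIntegrable (fun x =>
        Set.indicator {p : ℝ × ℝ | p.2 ≤ p.1} (fun p => v' p.1 * f p.2) (x, u)) volume c d := by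
      intro c d
      rw [intervalIntegrable_iff]
      have : (fun x => Set.indicator {p : ℝ × ℝ | p.2 ≤ p.1} (fun p => v' p.1 * f p.2) (x, u))
          = Set.indicator (Set.Ici u) (fun x => v' x * f u) := by
        ext x
        by_cases hx : u ≤ x <;> simp [Set.indicator, hx]
      rw [this]
      exact (intervalIntegrable_iff.1 ((hv'.mul continuous_const).intervalIntegrable c d)).indicator
        measurableSet_Ici
    rw [← intervalIntegral.integral_add_adjacent_intervals (hi a u) (hi u b), h3, h4, zero_add,
      intervalIntegral.integral_mul_const,
      intervalIntegral.integral_eq_sub_of_hasDerivAt (fun x _ => hv x)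
        (hv'.intervalIntegrable u b), sub_mul]
  rw [h1, hswap, intervalIntegral.integral_congr h2, intervalIntegral.integral_sub
    (hf.const_mul _) (hf.continuousOn_mul hvc.continuousOn), intervalIntegral.integral_const_mul]

lemma integral_deriv_mul_primitive {f v v' : ℝ → ℂ}
    (hf : ∀ a b, IntervalIntegrable f volume a b) (hv : ∀ x, HasDerivAt v (v' x) x)
    (hv' : Continuous v') (c a b : ℝ) :
    ∫ x in a..b, v' x * ∫ u in c..x, f u
      = v b * (∫ u in c..b, f u) - v a * (∫ u in c..a, f u) - ∫ x in a..b, v x * f x := by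
  have hF : Continuous fun x => ∫ u in c..x, f u :=
    intervalIntegral.continuous_primitive (fun a b => hf a b) c
  have key : ∀ a b, a ≤ b → ∫ x in a..b, v' x * ∫ u in c..x, f u
      = v b * (∫ u in c..b, f u) - v a * (∫ u in c..a, f u) - ∫ x in a..b, v x * f x := by
    intro a b hab
    have h0 : ∀ x, ∫ u in c..x, f u = (∫ u in c..a, f u) + ∫ u in a..x, f u := fun x =>
      (intervalIntegral.integral_add_adjacent_intervals (hf _ _) (hf _ _)).symm
    have hFa : Continuous fun x => ∫ u in a..x, f u :=
      intervalIntegral.continuous_primitive (fun a b => hf a b) a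
    rw [intervalIntegral.integral_congr (g := fun x =>
      v' x * (∫ u in c..a, f u) + v' x * ∫ u in a..x, f u)
      fun x _ => by simp only [h0 x, mul_add], h0 b]
    rw [intervalIntegral.integral_add (Continuous.intervalIntegrable (by fun_prop) _ _)
      (Continuous.intervalIntegrable (by fun_prop) _ _),
      integral_deriv_mul_primitive_of_le hab (hf _ _) hv hv',
      intervalIntegral.integral_mul_const,
      intervalIntegral.integral_eq_sub_of_hasDerivAt (fun x _ => hv x)
        (hv'.intervalIntegrable a b)]
    ring
  rcases le_total a b with h | h
  · exact key a b h
  · rw [intervalIntegral.integral_symm, key b a h, intervalIntegral.integral_symm a b]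
    ring

lemma sq_integral_le_integral_sq {g : ℝ → ℝ} (hg : Continuous g) :
    (∫ t in (0:ℝ)..1, g t) ^ 2 ≤ ∫ t in (0:ℝ)..1, g t ^ 2 := by
  set m := ∫ t in (0:ℝ)..1, g t with hm
  have h : 0 ≤ ∫ t in (0:ℝ)..1, (g t - m) ^ 2 :=
    intervalIntegral.integral_nonneg zero_le_one fun _ _ => sq_nonneg _
  have h2 : ∫ t in (0:ℝ)..1, (g t - m) ^ 2
      = (∫ t in (0:ℝ)..1, g t ^ 2) - 2 * m * m + m ^ 2 := by
    have : ∀ t, (g t - m) ^ 2 = (g t ^ 2 - 2 * m * g t) + m ^ 2 := fun t => by ring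
    simp_rw [this]
    rw [intervalIntegral.integral_add
      (Continuous.intervalIntegrable (by fun_prop) _ _) (by simp), intervalIntegral.integral_sub
      (Continuous.intervalIntegrable (by fun_prop) _ _)
      (Continuous.intervalIntegrable (by fun_prop) _ _), intervalIntegral.integral_const_mul, ← hm]
    simp
  nlinarith

/-- Hardy's inequality for averages of a periodic function along segments issuing from `α`. -/
lemma integral_sq_average_le {h : ℝ → ℝ} (hc : Continuous h)
    (hp : Function.Periodic h (2 * π)) (a α : ℝ) :
    ∫ β in a..(a + 2 * π), (∫ t in (0:ℝ)..1, h (t * β + (1 - t) * α)) ^ 2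
      ≤ 4 * ∫ x in (0:ℝ)..(2 * π), h x ^ 2 := by
  have hpi := Real.pi_pos
  have hsub : ∀ β, ∫ t in (0:ℝ)..1, h (t * β + (1 - t) * α)
      = ∫ s in (0:ℝ)..1, 2 * s * h (s ^ 2 * β + (1 - s ^ 2) * α) := by
    intro β
    have := intervalIntegral.integral_comp_mul_deriv (a := 0) (b := 1) (f := fun s : ℝ => s ^ 2)
      (f' := fun s => 2 * s) (g := fun t => h (t * β + (1 - t) * α))
      (fun x _ => by simpa using hasDerivAt_pow 2 x) (by fun_prop) (by fun_prop)
    simp only [Function.comp_def] at this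
    norm_num at this
    rw [← this]
    congr 1; ext s; ring
  have hin : ∀ s ∈ Set.Icc (0:ℝ) 1, ∫ β in a..(a + 2 * π),
      (2 * s * h (s ^ 2 * β + (1 - s ^ 2) * α)) ^ 2 ≤ 4 * ∫ x in (0:ℝ)..(2 * π), h x ^ 2 := by
    intro s hs
    have h1 : ∫ β in a..(a + 2 * π), (2 * s * h (s ^ 2 * β + (1 - s ^ 2) * α)) ^ 2
        = 4 * ∫ x in (s ^ 2 * a + (1 - s ^ 2) * α)..(s ^ 2 * (a + 2 * π) + (1 - s ^ 2) * α),
            h x ^ 2 := by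
      rw [← intervalIntegral.smul_integral_comp_mul_add (fun x => h x ^ 2), smul_eq_mul,
        ← mul_assoc, ← intervalIntegral.integral_const_mul]
      congr 1; ext β; ring
    rw [h1]
    have hs2 : s ^ 2 ≤ 1 := by nlinarith [hs.1, hs.2]
    have h2 := (show Function.Periodic (fun x => h x ^ 2) (2 * π) from fun x => by
      simp [hp x]).intervalIntegral_add_eq (s ^ 2 * a + (1 - s ^ 2) * α) 0
    rw [zero_add] at h2
    rw [← h2]
    refine mul_le_mul_of_nonneg_left (intervalIntegral.integral_mono_interval le_rfl
      (by nlinarith [sq_nonneg s]) (by nlinarith) (ae_of_all _ fun x => sq_nonneg _)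
      ((hc.pow 2).intervalIntegrable _ _)) (by norm_num)
  have hab : a ≤ a + 2 * π := by linarith
  calc ∫ β in a..(a + 2 * π), (∫ t in (0:ℝ)..1, h (t * β + (1 - t) * α)) ^ 2
      ≤ ∫ β in a..(a + 2 * π), ∫ s in (0:ℝ)..1,
          (2 * s * h (s ^ 2 * β + (1 - s ^ 2) * α)) ^ 2 := by
        refine intervalIntegral.integral_mono_on hab ?_ ?_ fun β _ => ?_
        · refine Continuous.intervalIntegrable ?_ _ _
          refine Continuous.pow ?_ 2
          exact intervalIntegral.continuous_parametric_intervalIntegral_of_continuous'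
            (by fun_prop) 0 1
        · refine Continuous.intervalIntegrable ?_ _ _
          exact intervalIntegral.continuous_parametric_intervalIntegral_of_continuous'
            (by fun_prop) 0 1
        · rw [hsub]
          exact sq_integral_le_integral_sq (by fun_prop)
    _ = ∫ s in (0:ℝ)..1, ∫ β in a..(a + 2 * π),
          (2 * s * h (s ^ 2 * β + (1 - s ^ 2) * α)) ^ 2 := by
        refine intervalIntegral_intervalIntegral_swap ?_
        refine IntegrableOn.mono_set (ContinuousOn.integrableOn_compact
          (isCompact_uIcc.prod isCompact_uIcc) (Continuous.continuousOn ?_))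
          (Set.prod_mono Set.uIoc_subset_uIcc Set.uIoc_subset_uIcc)
        fun_prop
    _ ≤ ∫ s in (0:ℝ)..1, 4 * ∫ x in (0:ℝ)..(2 * π), h x ^ 2 := by
        refine intervalIntegral.integral_mono_on zero_le_one ?_ (by simp) hin
        refine Continuous.intervalIntegrable ?_ _ _
        exact intervalIntegral.continuous_parametric_intervalIntegral_of_continuous'
          (by fun_prop) a _
    _ = 4 * ∫ x in (0:ℝ)..(2 * π), h x ^ 2 := by simp

/-- The trigonometric polynomial with coefficients `c` and frequencies in `s`. -/
def trigPoly (s : Finset ℤ) (c : ℤ → ℂ) (x : ℝ) : ℂ :=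
  ∑ n ∈ s, c n * Complex.exp (I * n * x)

@[fun_prop]
lemma continuous_trigPoly (s : Finset ℤ) (c : ℤ → ℂ) : Continuous (trigPoly s c) := by
  unfold trigPoly; fun_prop

lemma hasDerivAt_exp_I_mul (n : ℤ) (x : ℝ) :
    HasDerivAt (fun x : ℝ => Complex.exp (I * n * x)) (I * n * Complex.exp (I * n * x)) x := by
  have h := ((Complex.ofRealCLM.hasDerivAt (x := x)).const_mul (I * n)).cexp
  simpa [mul_comm] using h

lemma hasDerivAt_trigPoly (s : Finset ℤ) (c : ℤ → ℂ) (x : ℝ) :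
    HasDerivAt (trigPoly s c) (trigPoly s (fun n => (I * n) * c n) x) x := by
  unfold trigPoly
  refine HasDerivAt.fun_sum fun n _ => ?_
  exact ((hasDerivAt_exp_I_mul n x).const_mul (c n)).congr_deriv (by ring)

lemma norm_exp_I_mul (n : ℤ) (x : ℝ) : ‖Complex.exp (I * n * x)‖ = 1 := by
  have : I * n * x = ((n * x : ℝ) : ℂ) * I := by push_cast; ring
  rw [this, Complex.norm_exp_ofReal_mul_I]

lemma exp_I_mul_periodic (n : ℤ) :
    Function.Periodic (fun x : ℝ => Complex.exp (I * n * x)) (2 * π) := by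
  intro x
  have : I * n * ((x + 2 * π : ℝ) : ℂ) = I * n * x + n * (2 * π * I) := by push_cast; ring
  simp only
  rw [this, Complex.exp_add, Complex.exp_int_mul_two_pi_mul_I, mul_one]

lemma trigPoly_periodic (s : Finset ℤ) (c : ℤ → ℂ) :
    Function.Periodic (trigPoly s c) (2 * π) := fun x =>
  Finset.sum_congr rfl fun n _ => congrArg (c n * ·) (exp_I_mul_periodic n x)

lemma integral_exp_I_mul {n : ℤ} (hn : n ≠ 0) :
    ∫ x in (0:ℝ)..(2 * π), Complex.exp (I * n * x) = 0 := by
  rw [integral_exp_mul_complex (mul_ne_zero I_ne_zero (Int.cast_ne_zero.2 hn))]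
  have := exp_I_mul_periodic n 0
  simp only [zero_add] at this
  rw [this, sub_self, zero_div]

/-- Parseval's identity for trigonometric polynomials. -/
lemma integral_norm_sq_trigPoly (s : Finset ℤ) (c : ℤ → ℂ) :
    ∫ x in (0:ℝ)..(2 * π), ‖trigPoly s c x‖ ^ 2 = 2 * π * ∑ n ∈ s, ‖c n‖ ^ 2 := by
  have h : ∀ x, ((‖trigPoly s c x‖ ^ 2 : ℝ) : ℂ) = ∑ n ∈ s, ∑ m ∈ s,
      c n * (starRingEnd ℂ) (c m) * Complex.exp (I * (n - m : ℤ) * x) := by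
    intro x
    rw [ofReal_pow, ← Complex.mul_conj', trigPoly, map_sum, Finset.sum_mul_sum]
    refine Finset.sum_congr rfl fun n _ => Finset.sum_congr rfl fun m _ => ?_
    rw [map_mul, ← Complex.exp_conj]
    simp only [map_mul, conj_I, conj_ofReal, map_intCast, Int.cast_sub]
    rw [show I * ((n : ℂ) - m) * x = I * n * x + -I * m * x by ring, Complex.exp_add]
    ring
  apply Complex.ofReal_injective
  rw [← intervalIntegral.integral_ofReal]
  simp_rw [h]
  rw [intervalIntegral.integral_finsetSum fun n _ =>
    Continuous.intervalIntegrable (by fun_prop) _ _]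
  push_cast
  rw [Finset.mul_sum]
  refine Finset.sum_congr rfl fun n hn => ?_
  rw [intervalIntegral.integral_finsetSum fun n _ =>
    Continuous.intervalIntegrable (by fun_prop) _ _, Finset.sum_eq_single_of_mem n hn]
  · simp [Complex.mul_conj']
  · intro m _ hm
    have := integral_exp_I_mul (sub_ne_zero.2 (Ne.symm hm))
    push_cast at this
    rw [intervalIntegral.integral_const_mul, this, mul_zero]

/-- Differentiation under the integral sign for averages along affine families of points. -/
lemma hasDerivAt_integral_affine {w p r : ℝ → ℝ} (hw : Continuous w) (hp : Continuous p)
    (hr : Continuous r) {g g' : ℝ → ℂ} (hg : ∀ x, HasDerivAt g (g' x) x) (hg' : Continuous g')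
    (x : ℝ) :
    HasDerivAt (fun x => ∫ t in (0:ℝ)..1, (w t : ℂ) * g (p t * x + r t))
      (∫ t in (0:ℝ)..1, ((w t * p t : ℝ) : ℂ) * g' (p t * x + r t)) x := by
  have hgc : Continuous g := continuous_iff_continuousAt.2 fun x => (hg x).continuousAt
  have hcont : Continuous fun q : ℝ × ℝ =>
      ((w q.2 * p q.2 : ℝ) : ℂ) * g' (p q.2 * q.1 + r q.2) := by
    fun_prop
  obtain ⟨M, hM⟩ := ((isCompact_closedBall x 1).prod (isCompact_Icc (a := (0:ℝ)) (b := 1))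
    ).exists_bound_of_continuousOn hcont.continuousOn
  refine (intervalIntegral.hasDerivAt_integral_of_dominated_loc_of_deriv_le
    (F := fun x t => (w t : ℂ) * g (p t * x + r t))
    (F' := fun x t => ((w t * p t : ℝ) : ℂ) * g' (p t * x + r t))
    (bound := fun _ => M) (Metric.closedBall_mem_nhds x one_pos)
    (Eventually.of_forall fun y => Continuous.aestronglyMeasurable (by fun_prop))
    (Continuous.intervalIntegrable (by fun_prop) _ _)
    (Continuous.aestronglyMeasurable (by fun_prop))
    (ae_of_all _ fun t ht y hy => hM (y, t) ⟨hy, ?_⟩) (by simp)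
    (ae_of_all _ fun t _ y _ => ?_)).2
  · rw [Set.uIoc_of_le zero_le_one] at ht
    exact ⟨ht.1.le, ht.2⟩
  · have h1 : HasDerivAt (fun y : ℝ => p t * y + r t) (p t) y := by
      simpa using ((hasDerivAt_id y).const_mul (p t)).add_const (r t)
    have h2 := ((hg (p t * y + r t)).scomp y h1).const_mul (w t : ℂ)
    refine h2.congr_deriv ?_
    rw [Complex.real_smul]
    push_cast
    ring

lemma iteratedDeriv_integral_affine {w p r : ℝ → ℝ} (hw : Continuous w) (hp : Continuous p)
    (hr : Continuous r) (s : Finset ℤ) (c : ℤ → ℂ) (k : ℕ) :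
    iteratedDeriv k (fun x => ∫ t in (0:ℝ)..1, (w t : ℂ) * trigPoly s c (p t * x + r t))
      = fun x => ∫ t in (0:ℝ)..1, ((w t * p t ^ k : ℝ) : ℂ) *
          trigPoly s (fun n => (I * n) ^ k * c n) (p t * x + r t) := by
  induction k with
  | zero => simp
  | succ k ih =>
    rw [iteratedDeriv_succ, ih]
    ext x
    rw [(hasDerivAt_integral_affine (by fun_prop) hp hr (hasDerivAt_trigPoly s _)
      (by fun_prop) x).deriv]
    simp only [pow_succ, mul_assoc, mul_comm, mul_left_comm]

lemma integral_norm_sq_average_trigPoly_le {m : ℝ → ℝ} (hm : Continuous m)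
    (hm1 : ∀ t ∈ Set.Icc (0:ℝ) 1, |m t| ≤ 1) (s : Finset ℤ) (c : ℤ → ℂ) (a α : ℝ) :
    ∫ β in a..(a + 2 * π), ‖∫ t in (0:ℝ)..1, (m t : ℂ) * trigPoly s c (t * β + (1 - t) * α)‖ ^ 2
      ≤ 8 * π * ∑ n ∈ s, ‖c n‖ ^ 2 := by
  have h := integral_sq_average_le (h := fun x => ‖trigPoly s c x‖) (by fun_prop)
    (fun x => by simp only [trigPoly_periodic s c x]) a α
  rw [integral_norm_sq_trigPoly] at h
  refine le_trans ?_ (h.trans_eq (by ring))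
  have hc1 : Continuous fun β => ∫ t in (0:ℝ)..1, (m t : ℂ) * trigPoly s c (t * β + (1 - t) * α) :=
    intervalIntegral.continuous_parametric_intervalIntegral_of_continuous' (by fun_prop) 0 1
  have hc2 : Continuous fun β => ∫ t in (0:ℝ)..1, ‖trigPoly s c (t * β + (1 - t) * α)‖ :=
    intervalIntegral.continuous_parametric_intervalIntegral_of_continuous' (by fun_prop) 0 1
  refine intervalIntegral.integral_mono_on (by linarith [Real.pi_pos])
    (Continuous.intervalIntegrable (by fun_prop) _ _)
    (Continuous.intervalIntegrable (by fun_prop) _ _) fun β _ => ?_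
  refine pow_le_pow_left₀ (norm_nonneg _) ?_ 2
  refine (intervalIntegral.norm_integral_le_integral_norm zero_le_one).trans ?_
  refine intervalIntegral.integral_mono_on zero_le_one
    (Continuous.intervalIntegrable (by fun_prop) _ _)
    (Continuous.intervalIntegrable (by fun_prop) _ _) fun t ht => ?_
  rw [norm_mul, Complex.norm_real]
  exact mul_le_of_le_one_left (norm_nonneg _) (hm1 t ht)

/-- Fatou's lemma for integrals of squared norms. -/
lemma integral_norm_sq_le_of_tendsto {D : ℝ → ℂ} {u : ℕ → ℝ → ℂ} (hu : ∀ N, Continuous (u N))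
    {a b B : ℝ} (hab : a ≤ b) (hB0 : 0 ≤ B) (hB : ∀ N, ∫ x in a..b, ‖u N x‖ ^ 2 ≤ B)
    (h : ∀ᵐ x, Tendsto (fun N => u N x) atTop (nhds (D x))) :
    ∫ x in a..b, ‖D x‖ ^ 2 ≤ B := by
  rw [intervalIntegral.integral_of_le hab]
  have h' := ae_restrict_of_ae (s := Set.Ioc a b) h
  have hD : AEStronglyMeasurable D (volume.restrict (Set.Ioc a b)) :=
    aestronglyMeasurable_of_tendsto_ae _ (fun N => (hu N).aestronglyMeasurable) h'
  rw [integral_eq_lintegral_of_nonneg_ae (ae_of_all _ fun _ => sq_nonneg _)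
    (hD.norm.pow 2)]
  refine ENNReal.toReal_le_of_le_ofReal hB0 ?_
  have hlim : ∀ᵐ x ∂(volume.restrict (Set.Ioc a b)), ENNReal.ofReal (‖D x‖ ^ 2)
      = liminf (fun N => ENNReal.ofReal (‖u N x‖ ^ 2)) atTop := by
    filter_upwards [h'] with x hx
    exact ((ENNReal.continuous_ofReal.tendsto _).comp (hx.norm.pow 2)).liminf_eq.symm
  rw [lintegral_congr_ae hlim]
  refine (lintegral_liminf_le' fun N => by
    have := hu N
    exact (ENNReal.continuous_ofReal.comp (by fun_prop)).aemeasurable).trans ?_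
  refine liminf_le_of_le (by isBoundedDefault) fun x hx => ?_
  obtain ⟨N, hN⟩ := hx.exists
  refine hN.trans ?_
  have hc := hu N
  rw [← ofReal_integral_eq_lintegral_ofReal
    ((Continuous.intervalIntegrable (by fun_prop) a b).1) (ae_of_all _ fun _ => sq_nonneg _),
    ← intervalIntegral.integral_of_le hab]
  exact ENNReal.ofReal_le_ofReal (hB N)

/-- Convergence at `x` of the derivatives of order at most `k` of the functions `u N` to those
of `v`. -/
structure JetTendsto (k : ℕ) (u : ℕ → ℝ → ℂ) (v : ℝ → ℂ) (x : ℝ) : Prop where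
  contDiffAt_seq : ∀ N, ContDiffAt ℝ k (u N) x
  contDiffAt : ContDiffAt ℝ k v x
  tendsto : ∀ j ≤ k, Tendsto (fun N => iteratedDeriv j (u N) x) atTop (nhds (iteratedDeriv j v x))

namespace JetTendsto

variable {k : ℕ} {u₁ u₂ : ℕ → ℝ → ℂ} {v₁ v₂ : ℝ → ℂ} {x : ℝ}

lemma of_fixed {v : ℝ → ℂ} (hv : ContDiffAt ℝ k v x) : JetTendsto k (fun _ => v) v x :=
  ⟨fun _ => hv, hv, fun _ _ => tendsto_const_nhds⟩

lemma of_const {c : ℕ → ℂ} {d : ℂ} (h : Tendsto c atTop (nhds d)) :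
    JetTendsto k (fun N _ => c N) (fun _ => d) x := by
  refine ⟨fun _ => contDiffAt_const, contDiffAt_const, fun j _ => ?_⟩
  simp only [iteratedDeriv_const]
  split_ifs
  · exact h
  · exact tendsto_const_nhds

lemma add (h₁ : JetTendsto k u₁ v₁ x) (h₂ : JetTendsto k u₂ v₂ x) :
    JetTendsto k (fun N y => u₁ N y + u₂ N y) (fun y => v₁ y + v₂ y) x := by
  refine ⟨fun N => (h₁.1 N).add (h₂.1 N), h₁.2.add h₂.2, fun j hj => ?_⟩
  have hjk : ((j : ℕ) : WithTop ℕ∞) ≤ k := by exact_mod_cast hj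
  rw [iteratedDeriv_fun_add (h₁.2.of_le hjk) (h₂.2.of_le hjk)]
  simp_rw [iteratedDeriv_fun_add ((h₁.1 _).of_le hjk) ((h₂.1 _).of_le hjk)]
  exact (h₁.3 j hj).add (h₂.3 j hj)

lemma mul (h₁ : JetTendsto k u₁ v₁ x) (h₂ : JetTendsto k u₂ v₂ x) :
    JetTendsto k (fun N y => u₁ N y * u₂ N y) (fun y => v₁ y * v₂ y) x := by
  refine ⟨fun N => (h₁.1 N).mul (h₂.1 N), h₁.2.mul h₂.2, fun j hj => ?_⟩
  have hjk : ((j : ℕ) : WithTop ℕ∞) ≤ k := by exact_mod_cast hj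
  rw [iteratedDeriv_fun_mul (h₁.2.of_le hjk) (h₂.2.of_le hjk)]
  simp_rw [iteratedDeriv_fun_mul ((h₁.1 _).of_le hjk) ((h₂.1 _).of_le hjk)]
  refine tendsto_finsetSum _ fun i hi => ?_
  rw [Finset.mem_range] at hi
  exact ((h₁.3 i (by omega)).const_mul _).mul (h₂.3 (j - i) (by omega))

lemma neg (h : JetTendsto k u₁ v₁ x) :
    JetTendsto k (fun N y => -u₁ N y) (fun y => -v₁ y) x := by
  simpa using (of_fixed (v := fun _ => (-1 : ℂ)) contDiffAt_const).mul h

lemma sub (h₁ : JetTendsto k u₁ v₁ x) (h₂ : JetTendsto k u₂ v₂ x) :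
    JetTendsto k (fun N y => u₁ N y - u₂ N y) (fun y => v₁ y - v₂ y) x := by
  simpa [sub_eq_add_neg] using h₁.add h₂.neg

lemma congr {u : ℕ → ℝ → ℂ} {v : ℝ → ℂ} (h : JetTendsto k u₁ v₁ x)
    (hu : ∀ N, u N =ᶠ[nhds x] u₁ N) (hv : v =ᶠ[nhds x] v₁) : JetTendsto k u v x := by
  refine ⟨fun N => (h.1 N).congr_of_eventuallyEq (hu N), h.2.congr_of_eventuallyEq hv,
    fun j hj => ?_⟩
  rw [hv.iteratedDeriv_eq j]
  simp_rw [(hu _).iteratedDeriv_eq j]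
  exact h.3 j hj

/-- Jet convergence of order `k` of primitives follows from that of the derivatives. -/
lemma of_hasDerivAt (h : JetTendsto k u₁ v₁ x) (hu : ∀ N y, HasDerivAt (u₂ N) (u₁ N y) y)
    (hv : ∀ y, HasDerivAt v₂ (v₁ y) y)
    (h0 : Tendsto (fun N => u₂ N x) atTop (nhds (v₂ x))) :
    JetTendsto (k + 1) u₂ v₂ x := by
  have hdu : ∀ N, deriv (u₂ N) = u₁ N := fun N => funext fun y => (hu N y).deriv
  have hdv : deriv v₂ = v₁ := funext fun y => (hv y).deriv
  have hC : ∀ f g : ℝ → ℂ, (∀ y, HasDerivAt f (g y) y) → ContDiffAt ℝ k g x →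
      ContDiffAt ℝ ((k + 1 : ℕ) : WithTop ℕ∞) f x := by
    intro f g hfg hg
    rw [Nat.cast_add, Nat.cast_one, contDiffAt_succ_iff_hasFDerivAt]
    exact ⟨_, ⟨_, univ_mem, fun y _ => (hfg y).hasFDerivAt⟩,
      (ContinuousLinearMap.toSpanSingletonCLE (𝕜 := ℝ) (E := ℂ)).contDiff.contDiffAt.comp x hg⟩
  refine ⟨fun N => hC _ _ (hu N) (h.1 N), hC _ _ hv h.2, fun j hj => ?_⟩
  cases j with
  | zero => simpa using h0
  | succ j =>
    rw [iteratedDeriv_succ', hdv]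
    simp_rw [iteratedDeriv_succ', hdu]
    exact h.3 j (by omega)

lemma of_le {l : ℕ} (h : JetTendsto k u₁ v₁ x) (hl : l ≤ k) : JetTendsto l u₁ v₁ x :=
  ⟨fun N => (h.1 N).of_le (by exact_mod_cast hl), h.2.of_le (by exact_mod_cast hl),
    fun j hj => h.3 j (hj.trans hl)⟩

end JetTendsto

lemma jetTendsto_trigPoly {S : ℕ → Finset ℤ} (hS : Tendsto S atTop atTop) (x : ℝ) (k : ℕ) :
    ∀ {d : ℤ → ℂ}, (∀ j ≤ k, Summable fun n : ℤ => |(n : ℝ)| ^ j * ‖d n‖) →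
    JetTendsto k (fun N => trigPoly (S N) d) (fun x => ∑' n, d n * Complex.exp (I * n * x)) x := by
  have hsum : ∀ {d : ℤ → ℂ}, Summable (fun n => ‖d n‖) → ∀ x : ℝ,
      Tendsto (fun N => trigPoly (S N) d x) atTop
        (nhds (∑' n, d n * Complex.exp (I * n * x))) := by
    intro d hd x
    have h : HasSum (fun n => d n * Complex.exp (I * n * x)) _ :=
      (Summable.of_norm (by simpa [norm_exp_I_mul] using hd)).hasSum
    rw [HasSum, SummationFilter.unconditional_filter] at h
    exact h.comp hS
  induction k with
  | zero =>
    intro d hd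
    have hd0 : Summable fun n => ‖d n‖ := by simpa using hd 0 le_rfl
    have hc : Continuous fun x : ℝ => ∑' n, d n * Complex.exp (I * n * x) :=
      continuous_tsum (fun n => by fun_prop) hd0 fun n x => by simp [norm_exp_I_mul]
    refine ⟨fun N => ?_, ?_, fun j hj => ?_⟩
    · exact (contDiff_zero.2 (continuous_trigPoly _ _)).contDiffAt
    · exact (contDiff_zero.2 hc).contDiffAt
    · obtain rfl : j = 0 := by omega
      simpa using hsum hd0 x
  | succ k ih =>
    intro d hd
    have hd0 : Summable fun n => ‖d n‖ := by simpa using hd 0 (by omega)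
    have hd1 : Summable fun n : ℤ => |(n : ℝ)| * ‖d n‖ := by simpa using hd 1 (by omega)
    refine (ih (d := fun n => (I * n) * d n) fun j hj => ?_).of_hasDerivAt
      (fun N y => hasDerivAt_trigPoly _ _ y) (fun y => ?_) (hsum hd0 x)
    · refine (hd (j + 1) (by omega)).congr fun n => ?_
      simp [pow_succ, mul_assoc]
    · refine hasDerivAt_tsum (y₀ := 0) (g := fun n (y : ℝ) => d n * Complex.exp (I * n * y))
        (g' := fun n (y : ℝ) => I * n * d n * Complex.exp (I * n * y)) hd1
        (fun n y => ((hasDerivAt_exp_I_mul n y).const_mul (d n)).congr_deriv (by ring))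
        (fun n y => by simp [norm_exp_I_mul])
        (Summable.of_norm (by simpa [norm_exp_I_mul] using hd0)) y

/-- The Fourier series of a continuous periodic function with summable Fourier coefficients. -/
lemma hasSum_fc_of_summable {G : ℝ → ℂ} (hG : Continuous G) (hp : Function.Periodic G (2 * π))
    (hs : Summable (fc G)) (x : ℝ) :
    HasSum (fun n => fc G n * Complex.exp (I * n * x)) (G x) := by
  have : Fact (0 < 2 * π) := ⟨Real.two_pi_pos⟩
  let g : C(AddCircle (2 * π), ℂ) := ⟨hp.lift, continuous_coinduced_dom.2 hG⟩
  have hpi : (π : ℂ) ≠ 0 := by exact_mod_cast Real.pi_ne_zero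
  have hexp : ∀ (n : ℤ) (y : ℝ), fourier (T := 2 * π) n y = Complex.exp (I * n * y) := by
    intro n y
    rw [fourier_coe_apply]
    congr 1
    push_cast
    field_simp
  have hco : fourierCoeff g = fc G := by
    funext n
    rw [fourierCoeff_eq_intervalIntegral _ _ 0, fc, zero_add, Complex.real_smul]
    push_cast
    congr 1
    refine intervalIntegral.integral_congr fun y _ => ?_
    rw [hexp, smul_eq_mul, mul_comm]
    push_cast
    congr 2
    ring
  have h := has_pointwise_sum_fourier_series_of_summable (f := g) (by rwa [hco])
    (x : AddCircle (2 * π))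
  rw [hco] at h
  simp_rw [hexp, smul_eq_mul] at h
  exact h

/-- Fourier coefficients of the periodic part of a primitive. -/
lemma fc_primitive {f : ℝ → ℂ} (hf : ∀ a b, IntervalIntegrable f volume a b) {n : ℤ} (hn : n ≠ 0) :
    fc (fun x => (∫ u in (0:ℝ)..x, f u) - fc f 0 * x) n = fc f n / (I * n) := by
  have hpi : (π : ℂ) ≠ 0 := by exact_mod_cast Real.pi_ne_zero
  have hIn : I * (n : ℂ) ≠ 0 := mul_ne_zero I_ne_zero (Int.cast_ne_zero.2 hn)
  set h : ℝ → ℂ := fun x => f x - fc f 0 with hh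
  have hhi : ∀ a b, IntervalIntegrable h volume a b := fun a b => (hf a b).sub (by simp)
  have hprim : ∀ x, (∫ u in (0:ℝ)..x, f u) - fc f 0 * x = ∫ u in (0:ℝ)..x, h u := by
    intro x
    rw [hh, intervalIntegral.integral_sub (hf _ _) (by simp), intervalIntegral.integral_const]
    simp [mul_comm]
  have hend : ∫ u in (0:ℝ)..(2 * π), h u = 0 := by
    rw [← hprim]
    simp only [fc]
    simp
    field_simp
    ring
  have hE : ∀ x : ℝ, Complex.exp (-I * n * x) = Complex.exp (I * (-n : ℤ) * x) := by
    intro x; congr 1; push_cast; ring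
  have hibp := integral_deriv_mul_primitive (f := h)
    (v := fun x => (-(I * n))⁻¹ * Complex.exp (-I * n * x))
    (v' := fun x : ℝ => Complex.exp (-I * n * x)) hhi
    (fun x => by
      simp_rw [hE]
      refine ((hasDerivAt_exp_I_mul (-n) x).const_mul _).congr_deriv ?_
      push_cast
      field_simp) (by fun_prop) 0 0 (2 * π)
  rw [hend, intervalIntegral.integral_same, mul_zero, mul_zero, sub_zero, zero_sub] at hibp
  have hconst : ∫ x in (0:ℝ)..(2 * π), fc f 0 * Complex.exp (-I * n * x) = 0 := by
    simp_rw [hE]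
    rw [intervalIntegral.integral_const_mul, integral_exp_I_mul (neg_ne_zero.2 hn), mul_zero]
  have hhn : ∫ x in (0:ℝ)..(2 * π), h x * Complex.exp (-I * n * x)
      = ∫ x in (0:ℝ)..(2 * π), f x * Complex.exp (-I * n * x) := by
    simp_rw [hh, sub_mul]
    rw [intervalIntegral.integral_sub ((hf _ _).mul_continuousOn (by fun_prop))
      (Continuous.intervalIntegrable (by fun_prop) _ _), hconst, sub_zero]
  simp_rw [fc]
  rw [← hhn]
  have h2 : ∫ x in (0:ℝ)..(2 * π), (-(I * n))⁻¹ * Complex.exp (-I * n * x) * h x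
      = (-(I * n))⁻¹ * ∫ x in (0:ℝ)..(2 * π), h x * Complex.exp (-I * n * x) := by
    rw [← intervalIntegral.integral_const_mul]
    congr 1; ext x; ring
  have h3 : ∫ α in (0:ℝ)..(2 * π), ((∫ u in (0:ℝ)..α, f u) -
      (1 / (2 * (π : ℂ)) * ∫ α in (0:ℝ)..2 * π, f α * Complex.exp (-I * ((0 : ℤ) : ℂ) * α)) * α) *
        Complex.exp (-I * n * α)
      = ∫ x in (0:ℝ)..(2 * π), Complex.exp (-I * n * x) * ∫ u in (0:ℝ)..x, h u := by
    refine intervalIntegral.integral_congr fun x _ => ?_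
    rw [← hprim, fc, mul_comm]
  rw [h3, hibp, h2]
  field_simp

lemma summable_pow_mul_norm {k : ℕ} {c d : ℤ → ℂ}
    (hc : Summable fun n : ℤ => |(n : ℝ)| ^ (2 * (k : ℝ)) * ‖c n‖ ^ 2)
    (hd : ∀ n : ℤ, n ≠ 0 → d n = c n / (I * n)) {j : ℕ} (hj : j ≤ k) :
    Summable fun n : ℤ => |(n : ℝ)| ^ j * ‖d n‖ := by
  have h0 : Summable fun n : ℤ => if n = 0 then ‖d 0‖ else 0 := (hasSum_ite_eq 0 ‖d 0‖).summable
  have h2 : Summable fun n : ℤ => 1 / (n : ℝ) ^ 2 := Real.summable_one_div_int_pow.2 one_lt_two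
  refine Summable.of_nonneg_of_le (fun n => by positivity) (fun n => ?_) ((hc.add h2).add h0)
  by_cases hn : n = 0
  · subst hn
    have : (0:ℝ) ≤ |((0 : ℤ) : ℝ)| ^ (2 * (k : ℝ)) * ‖c 0‖ ^ 2 := by positivity
    have h1 : |((0 : ℤ) : ℝ)| ^ j * ‖d 0‖ ≤ ‖d 0‖ :=
      mul_le_of_le_one_left (norm_nonneg _) (pow_le_one₀ (abs_nonneg _) (by simp))
    simp only [if_true]
    norm_num at this h1 ⊢
    linarith
  · have hn1 : (1:ℝ) ≤ |(n : ℝ)| := by exact_mod_cast Int.one_le_abs hn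
    rw [if_neg hn, hd n hn, norm_div, norm_mul, norm_I, one_mul, Complex.norm_intCast, add_zero,
      mul_comm (2:ℝ), Real.rpow_mul (abs_nonneg _), Real.rpow_natCast, Real.rpow_two,
      ← sq_abs (n : ℝ)]
    set y := |(n : ℝ)|
    have hjk : y ^ j ≤ y ^ k := pow_le_pow_right₀ hn1 hj
    have hy : 0 < y := by linarith
    have h3 : y ^ j * (‖c n‖ / y) ≤ (y ^ k * ‖c n‖) * (1 / y) := by
      rw [mul_div_assoc', mul_one_div]
      gcongr
    have h4 : (y ^ k * ‖c n‖) * (1 / y) ≤ (y ^ k) ^ 2 * ‖c n‖ ^ 2 + 1 / y ^ 2 := by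
      rw [← mul_pow, ← one_div_pow]
      nlinarith [sq_nonneg (y ^ k * ‖c n‖ - 1 / y), sq_nonneg (y ^ k * ‖c n‖ + 1 / y),
        sq_nonneg (y ^ k * ‖c n‖), sq_nonneg (1 / y)]
    exact h3.trans h4

/-- The weighted average of `f` over the segment from `x` to `y`. -/
def segAvg (w : ℝ → ℝ) (f : ℝ → ℂ) (x y : ℝ) : ℂ :=
  ∫ t in (0:ℝ)..1, (w t : ℂ) * f ((1 - t) * x + t * y)

lemma segAvg_one {f F : ℝ → ℂ} (hF : ∀ a b, ∫ u in a..b, f u = F b - F a) {x y : ℝ}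
    (hxy : x ≠ y) : segAvg (fun _ => 1) f x y = (F x - F y) * ((x : ℂ) - y)⁻¹ := by
  have h : ∀ t : ℝ, ((1 : ℝ) : ℂ) * f ((1 - t) * x + t * y) = f (x + (y - x) * t) := by
    intro t
    rw [ofReal_one, one_mul]
    congr 1
    ring
  have hc : (x : ℂ) - y ≠ 0 := sub_ne_zero.2 (by exact_mod_cast hxy)
  have hc' : (y : ℂ) - x ≠ 0 := sub_ne_zero.2 (by exact_mod_cast hxy.symm)
  simp_rw [segAvg, h]
  rw [intervalIntegral.integral_comp_add_mul _ (sub_ne_zero.2 hxy.symm), hF, Complex.real_smul]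
  push_cast
  rw [mul_zero, add_zero, mul_one, add_sub_cancel]
  field_simp
  ring

lemma segAvg_sub_one {f F P : ℝ → ℂ} (hf : ∀ a b, IntervalIntegrable f volume a b)
    (hFi : ∀ a b, IntervalIntegrable F volume a b)
    (hF : ∀ a b, ∫ u in a..b, f u = F b - F a) (hP : ∀ a b, ∫ u in a..b, F u = P b - P a)
    {x y : ℝ} (hxy : x ≠ y) :
    segAvg (fun t => t - 1) f x y
      = -(((x : ℂ) - y) * F x + -(P x - P y)) * (((x : ℂ) - y)⁻¹ * ((x : ℂ) - y)⁻¹) := by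
  have hc : (x : ℂ) - y ≠ 0 := sub_ne_zero.2 (by exact_mod_cast hxy)
  have hc' : (y : ℂ) - x ≠ 0 := sub_ne_zero.2 (by exact_mod_cast hxy.symm)
  have h : ∀ t : ℝ, ((t - 1 : ℝ) : ℂ) * f ((1 - t) * x + t * y)
      = (fun u : ℝ => ((y : ℂ) - x)⁻¹ * (((u : ℂ) - y) * f u)) (x + (y - x) * t) := by
    intro t
    have : (1 - t) * x + t * y = x + (y - x) * t := by ring
    simp only [this]
    push_cast
    field_simp
    ring
  have hibp := integral_deriv_mul_primitive (f := f) (v := fun u : ℝ => (u : ℂ) - y)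
    (v' := fun _ => 1) hf (fun u => (hasDerivAt_id u).ofReal_comp.sub_const _)
    continuous_const x x y
  simp only [intervalIntegral.integral_same, sub_self, zero_mul, mul_zero, zero_sub, one_mul,
    hF] at hibp
  rw [intervalIntegral.integral_sub (hFi _ _) (by simp), hP, intervalIntegral.integral_const,
    Complex.real_smul] at hibp
  rw [segAvg, intervalIntegral.integral_congr fun t _ => h t,
    intervalIntegral.integral_comp_add_mul
      (fun u : ℝ => ((y : ℂ) - x)⁻¹ * (((u : ℂ) - y) * f u)) (sub_ne_zero.2 hxy.symm),
    intervalIntegral.integral_const_mul, Complex.real_smul, mul_zero, add_zero, mul_one,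
    add_sub_cancel, ← neg_eq_iff_eq_neg.2 hibp]
  push_cast
  field_simp
  ring

lemma contDiffAt_inv_ofReal_sub {k : ℕ} {α β : ℝ} (h : α ≠ β) :
    ContDiffAt ℝ k (fun x : ℝ => ((x : ℂ) - β)⁻¹) α := by
  refine ContDiffAt.inv (Complex.ofRealCLM.contDiff.contDiffAt.sub contDiffAt_const) ?_
  exact sub_ne_zero.2 (by exact_mod_cast h)

lemma contDiffAt_inv_sub_ofReal {k : ℕ} {α β : ℝ} (h : α ≠ β) :
    ContDiffAt ℝ k (fun y : ℝ => ((α : ℂ) - y)⁻¹) β := by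
  refine ContDiffAt.inv (contDiffAt_const.sub Complex.ofRealCLM.contDiff.contDiffAt) ?_
  exact sub_ne_zero.2 (by exact_mod_cast h)

section Jets

variable {k : ℕ} {f F P : ℝ → ℂ} {g G Q : ℕ → ℝ → ℂ} {α β : ℝ}

lemma JetTendsto.tendsto_self {u : ℕ → ℝ → ℂ} {v : ℝ → ℂ} {x : ℝ} (h : JetTendsto k u v x) :
    Tendsto (fun N => u N x) atTop (nhds (v x)) := by
  simpa using h.tendsto 0 (Nat.zero_le _)

lemma jetTendsto_segAvg_one_left (hF : ∀ a b, ∫ u in a..b, f u = F b - F a)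
    (hG : ∀ N a b, ∫ u in a..b, g N u = G N b - G N a) (hj : ∀ x, JetTendsto k G F x)
    (h : α ≠ β) :
    JetTendsto k (fun N x => segAvg (fun _ => 1) (g N) x β)
      (fun x => segAvg (fun _ => 1) f x β) α := by
  have hne : ∀ᶠ x in nhds α, x ≠ β := eventually_ne_nhds h
  refine (((hj α).sub (.of_const (hj β).tendsto_self)).mul
    (.of_fixed (contDiffAt_inv_ofReal_sub h))).congr (fun N => ?_) ?_
  · filter_upwards [hne] with x hx using segAvg_one (hG N) hx
  · filter_upwards [hne] with x hx using segAvg_one hF hx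

lemma jetTendsto_segAvg_one_right (hF : ∀ a b, ∫ u in a..b, f u = F b - F a)
    (hG : ∀ N a b, ∫ u in a..b, g N u = G N b - G N a) (hj : ∀ x, JetTendsto k G F x)
    (h : α ≠ β) :
    JetTendsto k (fun N y => segAvg (fun _ => 1) (g N) α y)
      (fun y => segAvg (fun _ => 1) f α y) β := by
  have hne : ∀ᶠ y in nhds β, α ≠ y := (eventually_ne_nhds h.symm).mono fun _ => Ne.symm
  refine ((JetTendsto.sub (.of_const (hj α).tendsto_self) (hj β)).mul
    (.of_fixed (contDiffAt_inv_sub_ofReal h))).congr (fun N => ?_) ?_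
  · filter_upwards [hne] with y hy using segAvg_one (hG N) hy
  · filter_upwards [hne] with y hy using segAvg_one hF hy

lemma jetTendsto_segAvg_sub_one_left (hf : ∀ a b, IntervalIntegrable f volume a b)
    (hFc : Continuous F) (hg : ∀ N, Continuous (g N)) (hGc : ∀ N, Continuous (G N))
    (hF : ∀ a b, ∫ u in a..b, f u = F b - F a) (hP : ∀ a b, ∫ u in a..b, F u = P b - P a)
    (hG : ∀ N a b, ∫ u in a..b, g N u = G N b - G N a)
    (hQ : ∀ N a b, ∫ u in a..b, G N u = Q N b - Q N a)
    (hj : ∀ x, JetTendsto k G F x) (hj' : ∀ x, JetTendsto k Q P x) (h : α ≠ β) :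
    JetTendsto k (fun N x => segAvg (fun t => t - 1) (g N) x β)
      (fun x => segAvg (fun t => t - 1) f x β) α := by
  have hne : ∀ᶠ x in nhds α, x ≠ β := eventually_ne_nhds h
  have hinv : JetTendsto k (fun _ (x : ℝ) => ((x : ℂ) - β)⁻¹) (fun x : ℝ => ((x : ℂ) - β)⁻¹) α :=
    .of_fixed (contDiffAt_inv_ofReal_sub h)
  have hlin : JetTendsto k (fun _ (x : ℝ) => (x : ℂ) - β) (fun x : ℝ => (x : ℂ) - β) α :=
    .of_fixed (Complex.ofRealCLM.contDiff.contDiffAt.sub contDiffAt_const)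
  refine ((((hlin.mul (hj α)).add
    ((hj' α).sub (.of_const (hj' β).tendsto_self)).neg).neg).mul (hinv.mul hinv)).congr
    (fun N => ?_) ?_
  · filter_upwards [hne] with x hx using segAvg_sub_one (fun _ _ => (hg N).intervalIntegrable _ _)
      (fun _ _ => (hGc N).intervalIntegrable _ _) (hG N) (hQ N) hx
  · filter_upwards [hne] with x hx using
      segAvg_sub_one hf (fun _ _ => hFc.intervalIntegrable _ _) hF hP hx

lemma jetTendsto_segAvg_sub_one_right (hf : ∀ a b, IntervalIntegrable f volume a b)
    (hFc : Continuous F) (hg : ∀ N, Continuous (g N)) (hGc : ∀ N, Continuous (G N))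
    (hF : ∀ a b, ∫ u in a..b, f u = F b - F a) (hP : ∀ a b, ∫ u in a..b, F u = P b - P a)
    (hG : ∀ N a b, ∫ u in a..b, g N u = G N b - G N a)
    (hQ : ∀ N a b, ∫ u in a..b, G N u = Q N b - Q N a)
    (hj : ∀ x, JetTendsto k G F x) (hj' : ∀ x, JetTendsto k Q P x) (h : α ≠ β) :
    JetTendsto k (fun N y => segAvg (fun t => t - 1) (g N) α y)
      (fun y => segAvg (fun t => t - 1) f α y) β := by
  have hne : ∀ᶠ y in nhds β, α ≠ y := (eventually_ne_nhds h.symm).mono fun _ => Ne.symm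
  have hinv : JetTendsto k (fun _ (y : ℝ) => ((α : ℂ) - y)⁻¹) (fun y : ℝ => ((α : ℂ) - y)⁻¹) β :=
    .of_fixed (contDiffAt_inv_sub_ofReal h)
  have hlin : JetTendsto k (fun _ (y : ℝ) => (α : ℂ) - y) (fun y : ℝ => (α : ℂ) - y) β :=
    .of_fixed (contDiffAt_const.sub Complex.ofRealCLM.contDiff.contDiffAt)
  refine ((((hlin.mul (.of_const (hj α).tendsto_self)).add
    (JetTendsto.sub (.of_const (hj' α).tendsto_self) (hj' β)).neg).neg).mul
    (hinv.mul hinv)).congr (fun N => ?_) ?_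
  · filter_upwards [hne] with y hy using segAvg_sub_one (fun _ _ => (hg N).intervalIntegrable _ _)
      (fun _ _ => (hGc N).intervalIntegrable _ _) (hG N) (hQ N) hy
  · filter_upwards [hne] with y hy using
      segAvg_sub_one hf (fun _ _ => hFc.intervalIntegrable _ _) hF hP hy

end Jets

lemma MemH.intervalIntegrable {s : ℝ} {f : ℝ → ℂ} (hf : MemH s f) (a b : ℝ) :
    IntervalIntegrable f volume a b :=
  hf.1.intervalIntegrable₀ Real.two_pi_pos.ne' hf.2.1 a b

/-- A primitive of an `H^k` function is a linear function plus its Fourier series. -/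
lemma MemH.exists_primitive {k : ℕ} {f : ℝ → ℂ} (hf : MemH k f) :
    ∃ d : ℤ → ℂ, (∀ n : ℤ, n ≠ 0 → d n = fc f n / (I * n)) ∧
      (∀ j ≤ k, Summable fun n : ℤ => |(n : ℝ)| ^ j * ‖d n‖) ∧
      ∀ x : ℝ, ∫ u in (0:ℝ)..x, f u = fc f 0 * x + ∑' n, d n * Complex.exp (I * n * x) := by
  have hpi : (π : ℂ) ≠ 0 := by exact_mod_cast Real.pi_ne_zero
  have hfi := hf.intervalIntegrable
  set G : ℝ → ℂ := fun x => (∫ u in (0:ℝ)..x, f u) - fc f 0 * x with hG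
  have hGc : Continuous G := (intervalIntegral.continuous_primitive hfi 0).sub (by fun_prop)
  have h2 : ∫ u in (0:ℝ)..(2 * π), f u = fc f 0 * (2 * π) := by
    simp only [fc]
    simp
    field_simp
  have hGp : Function.Periodic G (2 * π) := by
    intro x
    have h3 := hf.1.intervalIntegral_add_eq x 0
    rw [zero_add, h2] at h3
    simp only [hG]
    rw [← intervalIntegral.integral_add_adjacent_intervals (hfi 0 x) (hfi x _), h3]
    push_cast
    ring
  have hd : ∀ n : ℤ, n ≠ 0 → fc G n = fc f n / (I * n) := fun n hn => fc_primitive hfi hn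
  have hs : ∀ j ≤ k, Summable fun n : ℤ => |(n : ℝ)| ^ j * ‖fc G n‖ :=
    fun j hj => summable_pow_mul_norm hf.2.2 hd hj
  refine ⟨fc G, hd, hs, fun x => ?_⟩
  have hs0 : Summable (fc G) := Summable.of_norm (by simpa using hs 0 (Nat.zero_le _))
  rw [(hasSum_fc_of_summable hGc hGp hs0 x).tsum_eq, hG]
  ring

lemma integral_sub_primitive {F : ℝ → ℂ} (hF : ∀ a b, IntervalIntegrable F volume a b) (a b : ℝ) :
    ∫ u in a..b, F u = (∫ u in (0:ℝ)..b, F u) - ∫ u in (0:ℝ)..a, F u :=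
  (intervalIntegral.integral_interval_sub_left (hF _ _) (hF _ _)).symm

/-- First and second primitives of an `H^k` function are limits, together with their derivatives
of order at most `k`, of the primitives of its truncated Fourier series. -/
lemma MemH.exists_jetTendsto {k : ℕ} {f : ℝ → ℂ} (hf : MemH k f) {S : ℕ → Finset ℤ}
    (hS : Tendsto S atTop atTop) (hS0 : ∀ N, (0 : ℤ) ∈ S N) :
    ∃ (F P : ℝ → ℂ) (G Q : ℕ → ℝ → ℂ), Continuous F ∧ (∀ N, Continuous (G N)) ∧
      (∀ a b, ∫ u in a..b, f u = F b - F a) ∧ (∀ a b, ∫ u in a..b, F u = P b - P a) ∧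
      (∀ N a b, ∫ u in a..b, trigPoly (S N) (fc f) u = G N b - G N a) ∧
      (∀ N a b, ∫ u in a..b, G N u = Q N b - Q N a) ∧
      (∀ x, JetTendsto k G F x) ∧ ∀ x, JetTendsto k Q P x := by
  obtain ⟨d, hd, hs, hF⟩ := hf.exists_primitive
  have hfi := hf.intervalIntegrable
  set F : ℝ → ℂ := fun x => fc f 0 * x + ∑' n, d n * Complex.exp (I * n * x) with hFdef
  set G : ℕ → ℝ → ℂ := fun N x => fc f 0 * x + trigPoly (S N) d x with hGdef
  have hFc : Continuous F := by
    have : F = fun x => ∫ u in (0:ℝ)..x, f u := funext fun x => (hF x).symm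
    rw [this]
    exact intervalIntegral.continuous_primitive hfi 0
  have hGd : ∀ N x, HasDerivAt (G N) (trigPoly (S N) (fc f) x) x := by
    intro N x
    refine (((hasDerivAt_id x).ofReal_comp.const_mul (fc f 0)).add
      (hasDerivAt_trigPoly (S N) d x)).congr_deriv ?_
    simp only [trigPoly]
    rw [← Finset.add_sum_erase _ _ (hS0 N), ← Finset.add_sum_erase _ _ (hS0 N)]
    simp only [Int.cast_zero, mul_zero, zero_mul, Complex.exp_zero, ofReal_one, mul_one, zero_add]
    congr 1
    refine Finset.sum_congr rfl fun n hn => ?_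
    have hn0 : (n : ℂ) ≠ 0 := Int.cast_ne_zero.2 (Finset.ne_of_mem_erase hn)
    rw [hd n (Finset.ne_of_mem_erase hn), mul_div_cancel₀ _ (mul_ne_zero I_ne_zero hn0)]
  have hGc : ∀ N, Continuous (G N) :=
    fun N => continuous_iff_continuousAt.2 fun x => (hGd N x).continuousAt
  have hj : ∀ x, JetTendsto k G F x := fun x =>
    (JetTendsto.of_fixed (contDiff_const.mul Complex.ofRealCLM.contDiff).contDiffAt).add
      (jetTendsto_trigPoly hS x k hs)
  have hd0 : Summable fun n => ‖d n‖ := by simpa using hs 0 (Nat.zero_le _)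
  refine ⟨F, fun x => ∫ u in (0:ℝ)..x, F u, G, fun N x => ∫ u in (0:ℝ)..x, G N u, hFc, hGc,
    fun a b => ?_, integral_sub_primitive fun _ _ => hFc.intervalIntegrable _ _, fun N a b => ?_,
    fun N => integral_sub_primitive fun _ _ => (hGc N).intervalIntegrable _ _, hj, fun x => ?_⟩
  · rw [integral_sub_primitive hfi, hF, hF]
  · exact intervalIntegral.integral_eq_sub_of_hasDerivAt (fun x _ => hGd N x)
      ((continuous_trigPoly _ _).intervalIntegrable _ _)
  · refine ((hj x).of_hasDerivAt
      (fun N y => ((hGc N).integral_hasStrictDerivAt 0 y).hasDerivAt)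
      (fun y => (hFc.integral_hasStrictDerivAt 0 y).hasDerivAt) ?_).of_le (Nat.le_succ k)
    refine intervalIntegral.tendsto_integral_filter_of_dominated_convergence
      (fun u => ‖fc f 0‖ * |u| + ∑' n, ‖d n‖)
      (Eventually.of_forall fun N => (hGc N).aestronglyMeasurable)
      (Eventually.of_forall fun N => Eventually.of_forall fun u _ => ?_)
      (Continuous.intervalIntegrable (by fun_prop) _ _)
      (Eventually.of_forall fun u _ => (hj u).tendsto_self)
    refine (norm_add_le _ _).trans (add_le_add (by simp) ?_)
    refine (norm_sum_le _ _).trans ?_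
    simp only [norm_mul, norm_exp_I_mul, mul_one]
    exact hd0.sum_le_tsum _ fun n _ => norm_nonneg _

lemma sum_norm_sq_le_hnormSq {k : ℕ} {f : ℝ → ℂ} (hf : MemH k f) (s : Finset ℤ) :
    ∑ n ∈ s, ‖(I * n) ^ k * fc f n‖ ^ 2 ≤ hnormSq k f := by
  have h : ∀ n : ℤ, ‖(I * n) ^ k * fc f n‖ ^ 2
      = |(n : ℝ)| ^ (2 * (k : ℝ)) * ‖fc f n‖ ^ 2 := by
    intro n
    rw [norm_mul, norm_pow, norm_mul, norm_I, one_mul, Complex.norm_intCast, mul_pow,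
      mul_comm (2 : ℝ), Real.rpow_mul (abs_nonneg _), Real.rpow_natCast, Real.rpow_two]
  simp_rw [h]
  exact (hf.2.2.sum_le_tsum s fun n _ => by positivity).trans
    (le_add_of_nonneg_right (by positivity))

lemma continuous_integral_affine_trigPoly {m : ℝ → ℝ} (hm : Continuous m) (s : Finset ℤ)
    (c : ℤ → ℂ) (α : ℝ) :
    Continuous fun β : ℝ => ∫ t in (0:ℝ)..1, (m t : ℂ) * trigPoly s c (t * β + (1 - t) * α) := by
  refine intervalIntegral.continuous_parametric_intervalIntegral_of_continuous' ?_ _ _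
  simp only [Function.uncurry_def]
  fun_prop

lemma sqrt_integral_norm_sq_le_hnorm {k : ℕ} {f D : ℝ → ℂ} (hf : MemH k f) {S : ℕ → Finset ℤ}
    {m : ℝ → ℝ} (hm : Continuous m) (hm1 : ∀ t ∈ Set.Icc (0:ℝ) 1, |m t| ≤ 1) {a α : ℝ}
    (h : ∀ β ≠ α, Tendsto (fun N => ∫ t in (0:ℝ)..1, (m t : ℂ) *
      trigPoly (S N) (fun n => (I * n) ^ k * fc f n) (t * β + (1 - t) * α)) atTop (nhds (D β))) :
    Real.sqrt (∫ β in a..(a + 2 * π), ‖D β‖ ^ 2) ≤ Real.sqrt (8 * π) * hnorm k f := by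
  have h0 : 0 ≤ hnormSq k f := by
    rw [hnormSq]
    exact add_nonneg (tsum_nonneg fun n => by positivity) (by positivity)
  rw [hnorm, ← Real.sqrt_mul (by positivity)]
  refine Real.sqrt_le_sqrt (integral_norm_sq_le_of_tendsto
    (fun N => continuous_integral_affine_trigPoly hm (S N) (fun n => (I * n) ^ k * fc f n) α)
    (by linarith [Real.pi_pos]) (by positivity) (fun N => ?_) ?_)
  · exact (integral_norm_sq_average_trigPoly_le hm hm1 _ _ a α).trans
      (mul_le_mul_of_nonneg_left (sum_norm_sq_le_hnormSq hf _) (by positivity))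
  · filter_upwards [compl_mem_ae_iff.2 (measure_singleton α)] with β hβ using h β hβ

lemma sqrt_integral_iteratedDeriv_segAvg_left_le {k : ℕ} {f : ℝ → ℂ} (hf : MemH k f)
    {S : ℕ → Finset ℤ} {w : ℝ → ℝ} (hw : Continuous w) (hw1 : ∀ t ∈ Set.Icc (0:ℝ) 1, |w t| ≤ 1)
    {α : ℝ} (h : ∀ β, α ≠ β → JetTendsto k (fun N x => segAvg w (trigPoly (S N) (fc f)) x β)
      (fun x => segAvg w f x β) α) (a : ℝ) :
    Real.sqrt (∫ β in a..(a + 2 * π), ‖iteratedDeriv k (fun x => segAvg w f x β) α‖ ^ 2)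
      ≤ Real.sqrt (8 * π) * hnorm k f := by
  refine sqrt_integral_norm_sq_le_hnorm hf (S := S) (α := α) (m := fun t => w t * (1 - t) ^ k)
    (by fun_prop) (fun t ht => ?_) fun β hβ => ?_
  · rw [abs_mul, abs_pow]
    exact mul_le_one₀ (hw1 t ht) (by positivity)
      (pow_le_one₀ (abs_nonneg _) (abs_le.2 ⟨by linarith [ht.2], by linarith [ht.1]⟩))
  · refine ((h β hβ.symm).tendsto k le_rfl).congr fun N => ?_
    have := congrFun (iteratedDeriv_integral_affine (w := w) (p := fun t => 1 - t)
      (r := fun t => t * β) hw (by fun_prop) (by fun_prop) (S N) (fc f) k) α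
    refine this.trans ?_
    simp only [add_comm]

lemma sqrt_integral_iteratedDeriv_segAvg_right_le {k : ℕ} {f : ℝ → ℂ} (hf : MemH k f)
    {S : ℕ → Finset ℤ} {w : ℝ → ℝ} (hw : Continuous w) (hw1 : ∀ t ∈ Set.Icc (0:ℝ) 1, |w t| ≤ 1)
    {α : ℝ} (h : ∀ β, α ≠ β → JetTendsto k (fun N y => segAvg w (trigPoly (S N) (fc f)) α y)
      (fun y => segAvg w f α y) β) (a : ℝ) :
    Real.sqrt (∫ β in a..(a + 2 * π), ‖iteratedDeriv k (fun y => segAvg w f α y) β‖ ^ 2)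
      ≤ Real.sqrt (8 * π) * hnorm k f := by
  refine sqrt_integral_norm_sq_le_hnorm hf (S := S) (α := α) (m := fun t => w t * t ^ k)
    (by fun_prop) (fun t ht => ?_) fun β hβ => ?_
  · rw [abs_mul, abs_pow]
    exact mul_le_one₀ (hw1 t ht) (by positivity)
      (pow_le_one₀ (abs_nonneg _) (abs_le.2 ⟨by linarith [ht.1], ht.2⟩))
  · refine ((h β hβ.symm).tendsto k le_rfl).congr fun N => ?_
    have := congrFun (iteratedDeriv_integral_affine (w := w) (p := fun t => t)
      (r := fun t => (1 - t) * α) hw (by fun_prop) (by fun_prop) (S N) (fc f) k) β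
    rw [← this]
    simp only [segAvg, add_comm]

lemma q1_eq_segAvg (ω : ℝ → ℂ) (x y : ℝ) : q1 ω x y = segAvg (fun _ => 1) (deriv ω) x y := by
  have h := intervalIntegral.integral_comp_sub_left (a := 0) (b := 1)
    (fun t : ℝ => deriv ω (t * x + (1 - t) * y)) 1
  rw [sub_self, sub_zero] at h
  rw [q1, ← h, segAvg]
  simp

lemma q2_eq_segAvg (ω : ℝ → ℂ) (x y : ℝ) :
    q2 ω x y = segAvg (fun t => t - 1) (deriv (deriv ω)) x y := by
  simp [q2, segAvg]

/-- L² bounds on derivatives of the divided differences q₁ and q₂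
(Lemma 3.3). -/
theorem q1_q2_L2_bounds (k : ℕ) :
    ∃ C : ℝ, 0 < C ∧ ∀ ω : ℝ → ℂ, Function.Periodic ω (2*π) →
      (MemH k (deriv ω) →
        ∀ a α : ℝ,
          Real.sqrt (∫ β in a..(a+2*π), ‖iteratedDeriv k (fun x => q1 ω x β) α‖^2)
            ≤ C * hnorm k (deriv ω) ∧
          Real.sqrt (∫ β in a..(a+2*π), ‖iteratedDeriv k (fun y => q1 ω α y) β‖^2)
            ≤ C * hnorm k (deriv ω)) ∧
      (MemH k (deriv (deriv ω)) →
        ∀ a α : ℝ,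
          Real.sqrt (∫ β in a..(a+2*π), ‖iteratedDeriv k (fun x => q2 ω x β) α‖^2)
            ≤ C * hnorm k (deriv (deriv ω)) ∧
          Real.sqrt (∫ β in a..(a+2*π), ‖iteratedDeriv k (fun y => q2 ω α y) β‖^2)
            ≤ C * hnorm k (deriv (deriv ω))) := by
  have hS : Tendsto (fun N : ℕ => Finset.Icc (-(N : ℤ)) N) atTop atTop :=
    Finset.tendsto_Icc_neg
  have hS0 : ∀ N : ℕ, (0 : ℤ) ∈ Finset.Icc (-(N : ℤ)) N := fun N => by simp
  refine ⟨Real.sqrt (8 * π), by positivity, fun ω _ => ⟨fun hf a α => ?_, fun hf a α => ?_⟩⟩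
  · obtain ⟨F, P, G, Q, -, -, hF, -, hG, -, hj, -⟩ := hf.exists_jetTendsto hS hS0
    simp_rw [q1_eq_segAvg]
    exact ⟨sqrt_integral_iteratedDeriv_segAvg_left_le hf continuous_const (by simp)
        (fun β h => jetTendsto_segAvg_one_left hF hG hj h) a,
      sqrt_integral_iteratedDeriv_segAvg_right_le hf continuous_const (by simp)
        (fun β h => jetTendsto_segAvg_one_right hF hG hj h) a⟩
  · obtain ⟨F, P, G, Q, hFc, hGc, hF, hP, hG, hQ, hj, hj'⟩ := hf.exists_jetTendsto hS hS0
    have hw1 : ∀ t ∈ Set.Icc (0:ℝ) 1, |t - 1| ≤ 1 := fun t ht =>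
      abs_le.2 ⟨by linarith [ht.1], by linarith [ht.2]⟩
    have hfi := hf.intervalIntegrable
    simp_rw [q2_eq_segAvg]
    exact ⟨sqrt_integral_iteratedDeriv_segAvg_left_le hf (by fun_prop) hw1
        (fun β h => jetTendsto_segAvg_sub_one_left hfi hFc (fun _ => continuous_trigPoly _ _) hGc
          hF hP hG hQ hj hj' h) a,
      sqrt_integral_iteratedDeriv_segAvg_right_le hf (by fun_prop) hw1
        (fun β h => jetTendsto_segAvg_sub_one_right hfi hFc (fun _ => continuous_trigPoly _ _) hGc
          hF hP hG hQ hj hj' h) a⟩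

end HeleShaw
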